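/- A priori bound on the residual Gram matrix: along any solution of the continuous-time EnKF flow with y = A u†, the trace of R(t) is nonincreasing in time; in particular Tr(R(t)) ≤ Tr(R(0)) for all t ≥ 0, where R(t)_{lj} = ⟨A r^{(l)}(t), A r^{(j)}(t)⟩_Γ. -/

import Mathlib

open scoped BigOperators
open RealInnerProductSpace Matrix

noncomputable section

/-- The Γ-weighted inner product `⟨a,b⟩_Γ = ⟨Γ⁻¹ a, b⟩` on `ℝ^K`. -/
def gInner {K : ℕ} (Γ : Matrix (Fin K) (Fin K) ℝ)
    (a b : EuclideanSpace ℝ (Fin K)) : ℝ :=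
  ⟪Matrix.toEuclideanLin Γ⁻¹ a, b⟫

/-- Ensemble mean. -/
def ensMean {X : Type*} [AddCommGroup X] [Module ℝ X] {J : ℕ} (v : Fin J → X) : X :=
  (J : ℝ)⁻¹ • ∑ j, v j

/-- Right-hand side of the continuous-time EnKF flow. -/
def enkfRHS {X : Type*} [NormedAddCommGroup X] [InnerProductSpace ℝ X] {K J : ℕ}
    (A : X →L[ℝ] EuclideanSpace ℝ (Fin K)) (Γ : Matrix (Fin K) (Fin K) ℝ)
    (y : EuclideanSpace ℝ (Fin K)) (v : Fin J → X) (j : Fin J) : X :=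
  (J : ℝ)⁻¹ • ∑ k, gInner Γ (A (v k - ensMean v)) (y - A (v j)) • (v k - ensMean v)

/-- `u : ℝ → Fin J → X` solves the continuous-time EnKF flow on `[0,∞)`. -/
def IsEnKFSolution {X : Type*} [NormedAddCommGroup X] [InnerProductSpace ℝ X] {K J : ℕ}
    (A : X →L[ℝ] EuclideanSpace ℝ (Fin K)) (Γ : Matrix (Fin K) (Fin K) ℝ)
    (y : EuclideanSpace ℝ (Fin K)) (u : ℝ → Fin J → X) : Prop :=
  ∀ j : Fin J, ∀ t ∈ Set.Ici (0 : ℝ),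
    HasDerivWithinAt (fun s => u s j) (enkfRHS A Γ y (u t) j) (Set.Ici 0) t

/-- The deviation Gram matrix `E` of an ensemble. -/
def matE {X : Type*} [NormedAddCommGroup X] [InnerProductSpace ℝ X] {K J : ℕ}
    (A : X →L[ℝ] EuclideanSpace ℝ (Fin K)) (Γ : Matrix (Fin K) (Fin K) ℝ)
    (v : Fin J → X) : Matrix (Fin J) (Fin J) ℝ :=
  Matrix.of fun l j => gInner Γ (A (v l - ensMean v)) (A (v j - ensMean v))

/-- The residual/deviation cross Gram matrix `F` of an ensemble. -/
def matF {X : Type*} [NormedAddCommGroup X] [InnerProductSpace ℝ X] {K J : ℕ}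
    (A : X →L[ℝ] EuclideanSpace ℝ (Fin K)) (Γ : Matrix (Fin K) (Fin K) ℝ)
    (udag : X) (v : Fin J → X) : Matrix (Fin J) (Fin J) ℝ :=
  Matrix.of fun l j => gInner Γ (A (v l - udag)) (A (v j - ensMean v))

/-- The residual Gram matrix `R` of an ensemble. -/
def matR {X : Type*} [NormedAddCommGroup X] [InnerProductSpace ℝ X] {K J : ℕ}
    (A : X →L[ℝ] EuclideanSpace ℝ (Fin K)) (Γ : Matrix (Fin K) (Fin K) ℝ)
    (udag : X) (v : Fin J → X) : Matrix (Fin J) (Fin J) ℝ :=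
  Matrix.of fun l j => gInner Γ (A (v l - udag)) (A (v j - udag))

/-- The orthogonal complement of a subspace of `ℝ^K` w.r.t. the Γ-weighted inner product. -/
def gOrth {K : ℕ} (Γ : Matrix (Fin K) (Fin K) ℝ)
    (S : Submodule ℝ (EuclideanSpace ℝ (Fin K))) :
    Submodule ℝ (EuclideanSpace ℝ (Fin K)) where
  carrier := {w | ∀ v ∈ S, gInner Γ v w = 0}
  add_mem' := by
    intro a b ha hb v hv
    have h1 := ha v hv
    have h2 := hb v hv
    simp only [gInner, Set.mem_setOf_eq] at *
    rw [inner_add_right, h1, h2, add_zero]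
  zero_mem' := by
    intro v hv
    simp [gInner]
  smul_mem' := by
    intro c a ha v hv
    have h1 := ha v hv
    simp only [gInner, Set.mem_setOf_eq] at *
    rw [inner_smul_right, h1, mul_zero]

/-- The orthogonal complement of a subspace of `X` w.r.t. the inner product
`⟨v,w⟩_* = ⟨A v, A w⟩_Γ`. -/
def gOrthX {X : Type*} [NormedAddCommGroup X] [InnerProductSpace ℝ X] {K : ℕ}
    (A : X →L[ℝ] EuclideanSpace ℝ (Fin K)) (Γ : Matrix (Fin K) (Fin K) ℝ)
    (S : Submodule ℝ X) : Submodule ℝ X where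
  carrier := {w | ∀ v ∈ S, gInner Γ (A v) (A w) = 0}
  add_mem' := by
    intro a b ha hb v hv
    have h1 := ha v hv
    have h2 := hb v hv
    simp only [gInner, Set.mem_setOf_eq, map_add] at *
    rw [inner_add_right, h1, h2, add_zero]
  zero_mem' := by
    intro v hv
    simp [gInner]
  smul_mem' := by
    intro c a ha v hv
    have h1 := ha v hv
    simp only [gInner, Set.mem_setOf_eq, _root_.map_smul] at *
    rw [inner_smul_right, h1, mul_zero]


theorem gInner_symm {K : ℕ} {Γ : Matrix (Fin K) (Fin K) ℝ} (hΓ : Γ.PosDef)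
    (a b : EuclideanSpace ℝ (Fin K)) : gInner Γ a b = gInner Γ b a := by
  have h : (Matrix.toEuclideanLin Γ⁻¹).IsSymmetric :=
    Matrix.isSymmetric_toEuclideanLin_iff.mpr hΓ.isHermitian.inv
  unfold gInner
  rw [h a b, real_inner_comm]

theorem gInner_hasDeriv {K : ℕ} {Γ : Matrix (Fin K) (Fin K) ℝ} (hΓ : Γ.PosDef)
    {f : ℝ → EuclideanSpace ℝ (Fin K)} {f' : EuclideanSpace ℝ (Fin K)} {s : Set ℝ} {t : ℝ}
    (hf : HasDerivWithinAt f f' s t) :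
    HasDerivWithinAt (fun x => gInner Γ (f x) (f x)) (2 * gInner Γ f' (f t)) s t := by
  have h1 : HasDerivWithinAt (fun x => Matrix.toEuclideanLin Γ⁻¹ (f x))
      (Matrix.toEuclideanLin Γ⁻¹ f') s t :=
    (LinearMap.toContinuousLinearMap (Matrix.toEuclideanLin Γ⁻¹)).hasFDerivAt.comp_hasDerivWithinAt
      t hf
  have h2 := h1.inner ℝ hf
  have h3 := gInner_symm hΓ (f t) f'
  unfold gInner at *
  rw [h3, ← two_mul] at h2
  exact h2

theorem gInner_rhs {X : Type*} [NormedAddCommGroup X] [InnerProductSpace ℝ X] {K J : ℕ}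
    (A : X →L[ℝ] EuclideanSpace ℝ (Fin K)) (Γ : Matrix (Fin K) (Fin K) ℝ)
    (udag : X) (v : Fin J → X) (j : Fin J) :
    gInner Γ (A (enkfRHS A Γ (A udag) v j)) (A (v j - udag)) ≤ 0 := by
  have e : gInner Γ (A (enkfRHS A Γ (A udag) v j)) (A (v j - udag)) =
      -((J : ℝ)⁻¹ * ∑ k, gInner Γ (A (v k - ensMean v)) (A (v j - udag)) ^ 2) := by
    have hneg : A udag - A (v j) = -(A (v j - udag)) := by simp
    have hg : ∀ a b, gInner Γ a (-b) = - gInner Γ a b := fun a b => by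
      simp only [gInner, inner_neg_right]
    unfold enkfRHS
    rw [hneg]
    simp only [hg]
    rw [_root_.map_smul, map_sum]
    simp only [_root_.map_smul]
    conv_lhs => unfold gInner
    rw [_root_.map_smul, map_sum, real_inner_smul_left, sum_inner, ← mul_neg,
      ← Finset.sum_neg_distrib]
    congr 1
    refine Finset.sum_congr rfl fun k _ => ?_
    rw [_root_.map_smul, real_inner_smul_left]
    unfold gInner
    ring
  rw [e]
  have : 0 ≤ (J : ℝ)⁻¹ * ∑ k, gInner Γ (A (v k - ensMean v)) (A (v j - udag)) ^ 2 :=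
    mul_nonneg (by positivity) (Finset.sum_nonneg fun _ _ => sq_nonneg _)
  linarith

theorem enkf_residual_gram_trace_monotone
    {X : Type*} [NormedAddCommGroup X] [InnerProductSpace ℝ X]
    {K J : ℕ} (hJ : 0 < J)
    (A : X →L[ℝ] EuclideanSpace ℝ (Fin K))
    (Γ : Matrix (Fin K) (Fin K) ℝ) (hΓ : Γ.PosDef)
    (udag : X) (u : ℝ → Fin J → X)
    (hu : IsEnKFSolution A Γ (A udag) u) :
    AntitoneOn (fun t => (matR A Γ udag (u t)).trace) (Set.Ici 0) ∧
    ∀ t ∈ Set.Ici (0 : ℝ),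
      (matR A Γ udag (u t)).trace ≤ (matR A Γ udag (u 0)).trace := by
  have hd : ∀ t ∈ Set.Ici (0 : ℝ),
      HasDerivWithinAt (fun t => (matR A Γ udag (u t)).trace)
        (∑ j, 2 * gInner Γ (A (enkfRHS A Γ (A udag) (u t) j)) (A (u t j - udag)))
        (Set.Ici 0) t := by
    intro t ht
    simp only [Matrix.trace, Matrix.diag, matR, Matrix.of_apply]
    refine HasDerivWithinAt.fun_sum fun j _ => ?_
    exact gInner_hasDeriv hΓ (A.hasFDerivAt.comp_hasDerivWithinAt t ((hu j t ht).sub_const udag))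
  have hanti : AntitoneOn (fun t => (matR A Γ udag (u t)).trace) (Set.Ici 0) := by
    refine antitoneOn_of_hasDerivWithinAt_nonpos (convex_Ici 0)
      (fun t ht => (hd t ht).continuousWithinAt)
      (fun t ht => (hd t (interior_subset ht)).mono interior_subset) ?_
    intro t _
    refine Finset.sum_nonpos fun j _ => ?_
    have := gInner_rhs A Γ udag (u t) j
    linarith
  exact ⟨hanti, fun t ht => hanti (Set.mem_Ici.mpr le_rfl) ht ht⟩

end
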